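/- arXiv:1301.7276 — 2 statements merged into one kernel-verified Lean document; each statement's English description precedes it below -/
import Mathlib

section
/- Let k ≥ 1 be an integer, let c, x0, y0, y be real numbers with |c| < 1 and y ≠ y0, write d(x) = d_c(x−x0, y−y0), A(x) = (x−x0) + c(y−y0), and β_k = 1/((1−c^2)(2k−1)). Suppose g : ℝ → ℝ has derivative d(x)^{−(k−1)−1/2} at the point x. Then the function x ↦ (β_k/(y−y0)^2) · ( A(x)·d(x)^{−(k−1/2)} + 2(k−1)·g(x) ) has derivative at x equal to d(x)^{−(k+1/2)}. (This is the recursion F_{0k} in terms of F_{0(k−1)}.) -/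
/-- For a real parameter `c`, the quadratic form `d_c(x,y) = x^2 + 2cxy + y^2`. -/
def dQuad (c x y : ℝ) : ℝ := x ^ 2 + 2 * c * x * y + y ^ 2

theorem dQuad_eq_sq_add (c u v : ℝ) :
    dQuad c u v = (u + c * v) ^ 2 + (1 - c ^ 2) * v ^ 2 := by
  unfold dQuad
  ring

theorem dQuad_pos {c u v : ℝ} (hc : |c| < 1) (hv : v ≠ 0) : 0 < dQuad c u v := by
  have hc' : 0 < 1 - c ^ 2 := sub_pos.2 ((sq_lt_one_iff_abs_lt_one c).2 hc)
  rw [dQuad_eq_sq_add]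
  positivity

theorem hasDerivAt_dQuad_sub (c x0 v x : ℝ) :
    HasDerivAt (fun x => dQuad c (x - x0) v) (2 * ((x - x0) + c * v)) x := by
  have hu := (hasDerivAt_id' x).sub_const x0
  exact (((hu.pow 2).add ((hu.const_mul (2 * c)).mul_const v)).add_const (v ^ 2)).congr_deriv
    (by norm_num; ring)

/-- The recursion `F_{0k}` in terms of `F_{0(k−1)}`: with `d(x) = d_c(x−x0, y−y0)`,
`A(x) = (x−x0) + c(y−y0)` and `β_k = 1/((1−c²)(2k−1))`, if `g` has derivative
`d(x)^{−(k−1)−1/2}` at `x`, then `x ↦ (β_k/(y−y0)²)·(A(x)·d(x)^{−(k−1/2)} + 2(k−1)·g(x))`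
has derivative `d(x)^{−(k+1/2)}` at `x`. -/
theorem hasDerivAt_F0k (k : ℕ) (hk : 1 ≤ k) (c x0 y0 y : ℝ) (hc : |c| < 1) (hy : y ≠ y0)
    (g : ℝ → ℝ) (x : ℝ)
    (hg : HasDerivAt g ((dQuad c (x - x0) (y - y0)) ^ (-((k : ℝ) - 1) - 1 / 2)) x) :
    HasDerivAt
      (fun x : ℝ =>
        (1 / ((1 - c ^ 2) * (2 * (k : ℝ) - 1)) / (y - y0) ^ 2) *
          (((x - x0) + c * (y - y0)) * (dQuad c (x - x0) (y - y0)) ^ (-((k : ℝ) - 1 / 2)) +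
            2 * ((k : ℝ) - 1) * g x))
      ((dQuad c (x - x0) (y - y0)) ^ (-((k : ℝ) + 1 / 2))) x := by
  have hv : y - y0 ≠ 0 := sub_ne_zero.2 hy
  have hc' : 1 - c ^ 2 ≠ 0 := (sub_pos.2 ((sq_lt_one_iff_abs_lt_one c).2 hc)).ne'
  have hk' : 2 * (k : ℝ) - 1 ≠ 0 := by
    have : (1 : ℝ) ≤ k := by exact_mod_cast hk
    linarith
  have hd : 0 < dQuad c (x - x0) (y - y0) := dQuad_pos hc hv
  have hA := ((hasDerivAt_id' x).sub_const x0).add_const (c * (y - y0))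
  have hpow := (hasDerivAt_dQuad_sub c x0 (y - y0) x).rpow_const
    (p := -((k : ℝ) - 1 / 2)) (Or.inl hd.ne')
  refine (((hA.mul hpow).add (hg.const_mul (2 * ((k : ℝ) - 1)))).const_mul
    (1 / ((1 - c ^ 2) * (2 * (k : ℝ) - 1)) / (y - y0) ^ 2)).congr_deriv ?_
  rw [show -((k : ℝ) - 1) - 1 / 2 = -((k : ℝ) + 1 / 2) + 1 by ring,
    show -((k : ℝ) - 1 / 2) - 1 = -((k : ℝ) + 1 / 2) by ring,
    show -((k : ℝ) - 1 / 2) = -((k : ℝ) + 1 / 2) + 1 by ring,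
    Real.rpow_add_one hd.ne']
  generalize dQuad c (x - x0) (y - y0) ^ (-((k : ℝ) + 1 / 2)) = P
  rw [dQuad_eq_sq_add]
  field_simp
  ring
end

section
/- Let n ≥ 1, k ≥ 1 and m ≥ 0 be integers, let c, x0, y0 be real numbers with |c| < 1, let (x,y) ≠ (x0,y0), write d(x,y) = d_c(x−x0, y−y0) and β_k = 1/((1−c^2)(2k−1)). Then x^m·y^n·d(x,y)^{−(k+1/2)} = y0·x^m·y^{n−1}·d(x,y)^{−(k+1/2)} + β_k·( (n−1)·x^m·y^{n−2}·d(x,y)^{1/2−k} − c·m·x^{m−1}·y^{n−1}·d(x,y)^{1/2−k} − ∂_y( x^m·y^{n−1}·d(x,y)^{1/2−k} ) + c·∂_x( x^m·y^{n−1}·d(x,y)^{1/2−k} ) ), where ∂_x and ∂_y denote the partial derivatives at (x,y) and terms with factor (n−1) (resp. m) vanish when n = 1 (resp. m = 0). (This is the identity underlying the second recursion for C_{mnk} when m+n+1 = 2k.) -/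
theorem dQuad_comm (c x y : ℝ) : dQuad c x y = dQuad c y x := by
  unfold dQuad
  ring

theorem dQuad_pos_s9 {c : ℝ} (hc : |c| < 1) {x y : ℝ} (h : x ≠ 0 ∨ y ≠ 0) : 0 < dQuad c x y := by
  have hc2 : 0 < 1 - c ^ 2 := by
    have := (sq_lt_one_iff_abs_lt_one c).mpr hc
    linarith
  by_cases hy : y = 0
  · have hx : x ≠ 0 := h.resolve_right fun hy' => hy' hy
    have : dQuad c x y = x ^ 2 := by simp [dQuad, hy]
    rw [this]
    positivity
  · have : dQuad c x y = (x + c * y) ^ 2 + (1 - c ^ 2) * y ^ 2 := by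
      unfold dQuad
      ring
    rw [this]
    positivity

theorem hasDerivAt_dQuad_sub_left (c x0 x v : ℝ) :
    HasDerivAt (fun t => dQuad c (t - x0) v) (2 * (x - x0) + 2 * c * v) x := by
  have h : HasDerivAt (fun t : ℝ => t - x0) 1 x := (hasDerivAt_id x).sub_const x0
  exact (((h.fun_pow 2).fun_add ((h.const_mul (2 * c)).mul_const v)).add_const (v ^ 2)).congr_deriv
    (by norm_num)

theorem hasDerivAt_const_mul_pow_mul_dQuad_rpow {c x0 x v : ℝ} (hd : dQuad c (x - x0) v ≠ 0)
    (a p : ℝ) (m : ℕ) :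
    HasDerivAt (fun t => a * t ^ m * dQuad c (t - x0) v ^ p)
      (a * (m * x ^ (m - 1)) * dQuad c (x - x0) v ^ p +
        a * x ^ m * ((2 * (x - x0) + 2 * c * v) * p * dQuad c (x - x0) v ^ (p - 1))) x :=
  ((hasDerivAt_pow m x).const_mul a).mul
    ((hasDerivAt_dQuad_sub_left c x0 x v).rpow_const (Or.inl hd))

/-- The identity underlying the second recursion for `C_{mnk}` when `m+n+1 = 2k`:
with `d(x,y) = d_c(x−x0, y−y0)` and `β_k = 1/((1−c²)(2k−1))`, for `n ≥ 1`, `k ≥ 1`, `m ≥ 0`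
and `(x,y) ≠ (x0,y0)`,
`x^m·y^n·d^{−(k+1/2)} = y0·x^m·y^{n−1}·d^{−(k+1/2)} + β_k·((n−1)·x^m·y^{n−2}·d^{1/2−k}
  − c·m·x^{m−1}·y^{n−1}·d^{1/2−k} − ∂_y(x^m·y^{n−1}·d^{1/2−k}) + c·∂_x(x^m·y^{n−1}·d^{1/2−k}))`
(terms with factor `n−1` resp. `m` vanishing when `n = 1` resp. `m = 0`). -/
theorem recursion_Cmnk_second (m n k : ℕ) (hn : 1 ≤ n) (hk : 1 ≤ k) (c x0 y0 : ℝ)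
    (hc : |c| < 1) (x y : ℝ) (hxy : (x, y) ≠ (x0, y0)) :
    x ^ m * y ^ n * (dQuad c (x - x0) (y - y0)) ^ (-((k : ℝ) + 1 / 2)) =
      y0 * x ^ m * y ^ (n - 1) * (dQuad c (x - x0) (y - y0)) ^ (-((k : ℝ) + 1 / 2)) +
        (1 / ((1 - c ^ 2) * (2 * (k : ℝ) - 1))) *
          (((n : ℝ) - 1) * x ^ m * y ^ (n - 2) *
              (dQuad c (x - x0) (y - y0)) ^ (1 / 2 - (k : ℝ)) -
            c * (m : ℝ) * x ^ (m - 1) * y ^ (n - 1) *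
              (dQuad c (x - x0) (y - y0)) ^ (1 / 2 - (k : ℝ)) -
            deriv (fun y' : ℝ =>
              x ^ m * y' ^ (n - 1) * (dQuad c (x - x0) (y' - y0)) ^ (1 / 2 - (k : ℝ))) y +
            c * deriv (fun x' : ℝ =>
              x' ^ m * y ^ (n - 1) * (dQuad c (x' - x0) (y - y0)) ^ (1 / 2 - (k : ℝ))) x) := by
  have hd : 0 < dQuad c (x - x0) (y - y0) := by
    refine dQuad_pos_s9 hc ?_
    simpa only [ne_eq, sub_eq_zero, Prod.mk.injEq, not_and_or] using hxy
  have hd' : 0 < dQuad c (y - y0) (x - x0) := dQuad_comm c (x - x0) (y - y0) ▸ hd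
  have hx := (hasDerivAt_const_mul_pow_mul_dQuad_rpow hd.ne' (y ^ (n - 1)) (1 / 2 - (k : ℝ)) m).deriv
  have hy := (hasDerivAt_const_mul_pow_mul_dQuad_rpow hd'.ne' (x ^ m) (1 / 2 - (k : ℝ)) (n - 1)).deriv
  simp only [dQuad_comm c _ (x - x0)] at hy
  simp only [mul_comm (y ^ (n - 1)) (_ ^ m)] at hx
  rw [hx, hy, show (1 / 2 - (k : ℝ) - 1) = -((k : ℝ) + 1 / 2) by ring]
  generalize dQuad c (x - x0) (y - y0) ^ (-((k : ℝ) + 1 / 2)) = A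
  generalize dQuad c (x - x0) (y - y0) ^ (1 / 2 - (k : ℝ)) = B
  have hc2 : 1 - c ^ 2 ≠ 0 := by
    have := (sq_lt_one_iff_abs_lt_one c).mpr hc
    linarith
  have hk2 : 2 * (k : ℝ) - 1 ≠ 0 := by
    have : (1 : ℝ) ≤ k := by exact_mod_cast hk
    linarith
  obtain ⟨n, rfl⟩ := Nat.exists_eq_add_of_le' hn
  simp only [Nat.add_sub_cancel, show n + 1 - 2 = n - 1 by omega]
  push_cast
  field_simp
  ring
end
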